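/- For each fixed integer k ≥ 1 there exists a Borel probability measure ν on ℝ, supported on [0,+∞), whose moments are the numbers μ_k(m): for every integer m ≥ 1, ∫_ℝ t^m dν(t) = μ_k(m). -/

import Mathlib

open Filter Topology

open MeasureTheory

/-- `p^(-k) * Σ_{u ∈ (ℤ/p)^k} (1 - ρ_p(u)/p)^m`, where `ρ_p(u)` is the number of
distinct components of `u`. -/
noncomputable def halfTerm (k m : ℕ) (p : Nat.Primes) : ℝ :=
  haveI : NeZero (p : ℕ) := ⟨p.2.ne_zero⟩
  ((p : ℕ) : ℝ) ^ (-(k : ℤ)) *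
    ∑ u : Fin k → ZMod (p : ℕ), (1 - ((Set.range u).ncard : ℝ) / ((p : ℕ) : ℝ)) ^ m

/-- The `p`-factor `(1 - 1/p)^(-km) * (p^(-k) Σ_u (1 - ρ_p(u)/p)^m)` of `μ_k(m)`. -/
noncomputable def muFactor (k m : ℕ) (p : Nat.Primes) : ℝ :=
  (1 - 1 / ((p : ℕ) : ℝ)) ^ (-((k * m : ℕ) : ℤ)) * halfTerm k m p

/-- `μ_k(m)`, the Euler product over all primes. -/
noncomputable def muMoment (k m : ℕ) : ℝ :=
  ∏' p : Nat.Primes, muFactor k m p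


section InfiniteProducts

variable {ι : Type*} {μ : ι → Measure ℝ} [∀ i, IsProbabilityMeasure (μ i)]

lemma integral_finsetProd_infinitePi {f : ι → ℝ → ℝ} (hf : ∀ i, Measurable (f i)) (s : Finset ι) :
    ∫ ω, ∏ i ∈ s, f i (ω i) ∂(Measure.infinitePi μ) = ∏ i ∈ s, ∫ x, f i x ∂(μ i) := by
  have h := (ProbabilityTheory.iIndepFun_infinitePi (P := μ) hf).precomp
    (Subtype.val_injective (p := (· ∈ s)))
  have h' := h.integral_fun_prod_eq_prod_integral (fun i ↦ by
    have := hf i.1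
    exact Measurable.aestronglyMeasurable (by fun_prop))
  simp_rw [← Finset.prod_coe_sort s]
  refine h'.trans ?_
  refine Finset.prod_congr rfl fun i _ ↦ ?_
  have e := measurePreserving_eval_infinitePi μ i.1
  conv_rhs => rw [← e.map_eq]
  exact (integral_map e.measurable.aemeasurable (hf i.1).aestronglyMeasurable).symm

lemma integral_exp_mul_le {ρ : Measure ℝ} [IsProbabilityMeasure ρ] {g : ℝ → ℝ} (hg : Measurable g)
    {B c : ℝ} (hc : 0 ≤ c) (hB : ∀ᵐ x ∂ρ, 0 ≤ g x ∧ g x ≤ B) :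
    ∫ x, Real.exp (c * g x) ∂ρ ≤ Real.exp (c * Real.exp (c * B) * ∫ x, g x ∂ρ) := by
  have hint : Integrable g ρ := .of_bound hg.aestronglyMeasurable B (by
    filter_upwards [hB] with x hx
    rw [Real.norm_of_nonneg hx.1]; exact hx.2)
  calc ∫ x, Real.exp (c * g x) ∂ρ ≤ ∫ x, (c * Real.exp (c * B) * g x + 1) ∂ρ := by
        refine integral_mono_of_nonneg (ae_of_all _ fun x ↦ (Real.exp_pos _).le)
          ((hint.const_mul _).add (integrable_const _)) ?_
        filter_upwards [hB] with x hx
        have h1 : 1 - c * g x ≤ Real.exp (-(c * g x)) := by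
          have := Real.add_one_le_exp (-(c * g x)); linarith
        have h2 : Real.exp (c * g x) * Real.exp (-(c * g x)) = 1 := by
          rw [← Real.exp_add]; simp
        have h3 : Real.exp (c * g x) ≤ Real.exp (c * B) := by
          gcongr; exact hx.2
        have h4 : 0 ≤ c * g x := mul_nonneg hc hx.1
        nlinarith [Real.exp_pos (c * g x)]
    _ = c * Real.exp (c * B) * ∫ x, g x ∂ρ + 1 := by
        rw [integral_add (hint.const_mul _) (integrable_const _), integral_const_mul]
        simp
    _ ≤ _ := Real.add_one_le_exp _

variable [Countable ι]

lemma exists_integrable_bound_exp_sum {g : ℝ → ℝ} (hg : Measurable g) {B c : ℝ} (hc : 0 < c)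
    (hB : ∀ i, ∀ᵐ x ∂(μ i), 0 ≤ g x ∧ g x ≤ B)
    (hs : Summable fun i ↦ ∫ x, g x ∂(μ i)) :
    ∃ W : (ι → ℝ) → ℝ, Integrable W (Measure.infinitePi μ) ∧ ∀ᵐ ω ∂(Measure.infinitePi μ),
      ∀ s : Finset ι, Real.exp (c * ∑ i ∈ s, g (ω i)) ≤ W ω := by
  have hB' : ∀ᵐ ω ∂(Measure.infinitePi μ), ∀ i, 0 ≤ g (ω i) ∧ g (ω i) ≤ B :=
    ae_all_iff.2 fun i ↦ (measurePreserving_eval_infinitePi μ i).quasiMeasurePreserving.ae (hB i)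
  set F : Finset ι → (ι → ℝ) → ENNReal :=
    fun s ω ↦ ENNReal.ofReal (Real.exp (c * ∑ i ∈ s, |g (ω i)|)) with hF
  have hFm : ∀ s, Measurable (F s) := fun s ↦ by fun_prop
  set K : ℝ := c * Real.exp (c * B)
  have hK : 0 ≤ K := by positivity
  have hpos : ∀ i, 0 ≤ ∫ x, g x ∂(μ i) := fun i ↦
    integral_nonneg_of_ae ((hB i).mono fun x hx ↦ hx.1)
  have hle : ∀ s, ∫⁻ ω, F s ω ∂(Measure.infinitePi μ)
      ≤ ENNReal.ofReal (Real.exp (K * ∑' i, ∫ x, g x ∂(μ i))) := fun s ↦ by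
    have hint : Integrable (fun ω : ι → ℝ ↦ Real.exp (c * ∑ i ∈ s, |g (ω i)|))
        (Measure.infinitePi μ) := by
      refine .of_bound (Measurable.aestronglyMeasurable (by fun_prop))
        (Real.exp (c * ∑ i ∈ s, B)) ?_
      filter_upwards [hB'] with ω hω
      rw [Real.norm_of_nonneg (Real.exp_pos _).le]
      gcongr with i
      rw [abs_of_nonneg (hω i).1]
      exact (hω i).2
    rw [hF, ← ofReal_integral_eq_lintegral_ofReal hint (ae_of_all _ fun ω ↦ (Real.exp_pos _).le)]
    refine ENNReal.ofReal_le_ofReal ?_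
    simp_rw [Finset.mul_sum, Real.exp_sum]
    rw [integral_finsetProd_infinitePi (f := fun _ x ↦ Real.exp (c * |g x|)) (fun i ↦ by fun_prop)]
    calc _ ≤ ∏ i ∈ s, Real.exp (K * ∫ x, g x ∂(μ i)) := by
          refine Finset.prod_le_prod (fun i _ ↦ integral_nonneg fun x ↦ (Real.exp_pos _).le)
            fun i _ ↦ ?_
          rw [integral_congr_ae (g := fun x ↦ Real.exp (c * g x))
            ((hB i).mono fun x hx ↦ by simp only [abs_of_nonneg hx.1])]
          exact integral_exp_mul_le hg hc.le (hB i)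
      _ = Real.exp (K * ∑ i ∈ s, ∫ x, g x ∂(μ i)) := by rw [← Real.exp_sum, Finset.mul_sum]
      _ ≤ _ := by
          gcongr
          exact hs.sum_le_tsum s fun i _ ↦ hpos i
  have hmono : Monotone F := fun s t hst ω ↦ by
    simp only [hF]
    gcongr
  have hsup : ∫⁻ ω, ⨆ s, F s ω ∂(Measure.infinitePi μ) ≠ ⊤ := by
    rw [lintegral_iSup_directed (fun s ↦ (hFm s).aemeasurable) hmono.directed_le]
    exact ne_top_of_le_ne_top ENNReal.ofReal_ne_top (iSup_le hle)
  have hsm : Measurable fun ω ↦ ⨆ s, F s ω := .iSup hFm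
  refine ⟨fun ω ↦ (⨆ s, F s ω).toReal,
    integrable_toReal_of_lintegral_ne_top hsm.aemeasurable hsup, ?_⟩
  filter_upwards [hB', ae_lt_top hsm hsup] with ω hω hlt s
  rw [← ENNReal.ofReal_le_iff_le_toReal hlt.ne]
  refine le_trans ?_ (le_iSup (fun s ↦ F s ω) s)
  simp only [hF, abs_of_nonneg (hω _).1, le_refl]

lemma abs_pow_sub_one_le {x B : ℝ} (hx : 0 ≤ x) (hxB : x ≤ B) (m : ℕ) :
    |x ^ m - 1| ≤ (∑ i ∈ Finset.range m, B ^ i) * |x - 1| := by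
  rw [← geom_sum_mul, abs_mul, abs_of_nonneg (by positivity)]
  gcongr

theorem exists_measure_moments_eq_tprod (B : ℝ) (hB : ∀ i, ∀ᵐ x ∂(μ i), 0 ≤ x ∧ x ≤ B)
    (hs : Summable fun i ↦ ∫ x, |x - 1| ∂(μ i)) :
    ∃ ν : Measure ℝ, IsProbabilityMeasure ν ∧ ν (Set.Iio 0) = 0 ∧
      ∀ m : ℕ, 1 ≤ m → ∫ t, t ^ m ∂ν = ∏' i, ∫ x, x ^ m ∂(μ i) := by
  have hB' : ∀ᵐ ω ∂(Measure.infinitePi μ), ∀ i, 0 ≤ ω i ∧ ω i ≤ B :=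
    ae_all_iff.2 fun i ↦ (measurePreserving_eval_infinitePi μ i).quasiMeasurePreserving.ae (hB i)
  have hY : ∀ i, ∀ᵐ x ∂(μ i), 0 ≤ |x - 1| ∧ |x - 1| ≤ B + 1 := fun i ↦
    (hB i).mono fun x hx ↦ ⟨abs_nonneg _, abs_le.2 ⟨by linarith, by linarith⟩⟩
  have hbound (c : ℝ) (hc : 0 < c) := exists_integrable_bound_exp_sum (g := fun x ↦ |x - 1|)
    (by fun_prop) hc hY hs
  set Z : (ι → ℝ) → ℝ := fun ω ↦ ∏' i, ω i with hZ
  have hlim : ∀ᵐ ω ∂(Measure.infinitePi μ),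
      Tendsto (fun s : Finset ι ↦ ∏ i ∈ s, ω i) atTop (𝓝 (Z ω)) := by
    obtain ⟨W, -, hW⟩ := hbound 1 one_pos
    filter_upwards [hW] with ω hω
    have hsum : Summable fun i ↦ |ω i - 1| :=
      summable_of_sum_le (fun _ ↦ abs_nonneg _) (c := W ω) fun s ↦ by
        have := hω s
        have := Real.add_one_le_exp (1 * ∑ i ∈ s, |ω i - 1|)
        linarith
    have := multipliable_one_add_of_summable (f := fun i ↦ ω i - 1) (by simpa using hsum)
    simp only [add_sub_cancel] at this
    exact this.hasProd
  have hZm : AEMeasurable Z (Measure.infinitePi μ) :=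
    aemeasurable_of_tendsto_metrizable_ae atTop
      (fun s ↦ Measurable.aemeasurable (by fun_prop)) hlim
  refine ⟨(Measure.infinitePi μ).map Z, Measure.isProbabilityMeasure_map hZm, ?_, fun m hm ↦ ?_⟩
  · rw [Measure.map_apply_of_aemeasurable hZm measurableSet_Iio, measure_eq_zero_iff_ae_notMem]
    filter_upwards [hB'] with ω hω
    simpa [hZ] using tprod_nonneg fun i ↦ (hω i).1
  · rw [integral_map hZm (by fun_prop)]
    have h1 : Tendsto (fun s : Finset ι ↦ ∫ ω, (∏ i ∈ s, ω i) ^ m ∂(Measure.infinitePi μ)) atTop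
        (𝓝 (∫ ω, Z ω ^ m ∂(Measure.infinitePi μ))) := by
      obtain ⟨W, hWint, hW⟩ := hbound m (by exact_mod_cast hm)
      refine tendsto_integral_filter_of_dominated_convergence W
        (.of_forall fun s ↦ Measurable.aestronglyMeasurable (by fun_prop))
        (.of_forall fun s ↦ ?_) hWint (hlim.mono fun ω hω ↦ hω.pow m)
      filter_upwards [hW, hB'] with ω hω hω'
      have hp : 0 ≤ ∏ i ∈ s, ω i := Finset.prod_nonneg fun i _ ↦ (hω' i).1
      rw [Real.norm_of_nonneg (by positivity)]
      refine le_trans ?_ (hω s)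
      rw [Real.exp_nat_mul, Real.exp_sum]
      gcongr with i _
      · exact fun i _ ↦ (hω' i).1
      · have := Real.add_one_le_exp |ω i - 1|
        have := le_abs_self (ω i - 1)
        linarith
    have h2 : ∀ s : Finset ι, ∫ ω, (∏ i ∈ s, ω i) ^ m ∂(Measure.infinitePi μ)
        = ∏ i ∈ s, ∫ x, x ^ m ∂(μ i) := fun s ↦ by
      simp_rw [← Finset.prod_pow]
      exact integral_finsetProd_infinitePi (f := fun _ x ↦ x ^ m) (fun i ↦ by fun_prop) s
    simp_rw [h2] at h1
    have hbd : ∀ i (f : ℝ → ℝ), Continuous f → Integrable f (μ i) := fun i f hf ↦ by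
      obtain ⟨C, hC⟩ := (isCompact_Icc (a := 0) (b := B)).exists_bound_of_continuousOn hf.continuousOn
      exact .of_bound hf.aestronglyMeasurable C ((hB i).mono fun x hx ↦ hC x hx)
    have hmul : Multipliable fun i ↦ ∫ x, x ^ m ∂(μ i) := by
      have := multipliable_one_add_of_summable (f := fun i ↦ ∫ x, (x ^ m - 1) ∂(μ i)) <|
        (hs.mul_left (∑ i ∈ Finset.range m, B ^ i)).of_nonneg_of_le (fun _ ↦ norm_nonneg _)
          fun i ↦ by
            refine (norm_integral_le_integral_norm _).trans ?_
            rw [← integral_const_mul]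
            refine integral_mono_ae (hbd i _ (by fun_prop)) (hbd i _ (by fun_prop)) ?_
            filter_upwards [hB i] with x hx
            exact abs_pow_sub_one_le hx.1 hx.2 m
      convert! this using 2 with i
      rw [integral_sub (hbd i _ (by fun_prop)) (integrable_const _)]
      simp
    exact tendsto_nhds_unique h1 hmul.hasProd

end InfiniteProducts

section UniformLaw

variable {α : Type*} [Fintype α]

/-- The law of `X u` for `u` uniformly distributed on the finite type `α`. -/
noncomputable def uniformLaw (X : α → ℝ) : Measure ℝ :=
  ∑ u, (Fintype.card α : ENNReal)⁻¹ • Measure.dirac (X u)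

instance [Nonempty α] (X : α → ℝ) : IsProbabilityMeasure (uniformLaw X) where
  measure_univ := by
    simp only [uniformLaw, Measure.coe_finsetSum, Finset.sum_apply, Measure.smul_apply,
      measure_univ, smul_eq_mul, mul_one, Finset.sum_const, Finset.card_univ, nsmul_eq_mul]
    exact ENNReal.mul_inv_cancel (by simp) (by simp)

lemma integral_uniformLaw [Nonempty α] (X : α → ℝ) (f : ℝ → ℝ) :
    ∫ x, f x ∂(uniformLaw X) = (Fintype.card α : ℝ)⁻¹ * ∑ u, f (X u) := by
  rw [uniformLaw, integral_finsetSum_measure, Finset.mul_sum]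
  · simp
  · exact fun u _ ↦ (integrable_dirac (by simp)).smul_measure (by simp)

lemma ae_uniformLaw {X : α → ℝ} {P : ℝ → Prop} (hP : MeasurableSet {x | P x})
    (h : ∀ u, P (X u)) : ∀ᵐ x ∂(uniformLaw X), P x := by
  rw [ae_iff, uniformLaw]
  simp only [Measure.coe_finsetSum, Finset.sum_apply, Measure.smul_apply, smul_eq_mul]
  refine Finset.sum_eq_zero fun u _ ↦ ?_
  rw [← Set.compl_ofPred, Measure.dirac_apply' _ hP.compl]
  simp [h u]

end UniformLaw

section Residues

lemma sum_one_sub_ncard_range_div {α : Type*} [Fintype α] [Nonempty α] (k : ℕ) :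
    ∑ u : Fin k → α, (1 - ((Set.range u).ncard : ℝ) / Fintype.card α)
      = (Fintype.card α : ℝ) ^ k * (1 - 1 / (Fintype.card α : ℝ)) ^ k := by
  classical
  have hq : (Fintype.card α : ℝ) ≠ 0 := by simp
  have h1 : ∀ u : Fin k → α, 1 - ((Set.range u).ncard : ℝ) / Fintype.card α
      = (∑ r : α, if ∀ i, u i ≠ r then (1 : ℝ) else 0) / Fintype.card α := fun u ↦ by
    have h2 : (Finset.univ.filter fun r : α ↦ ∀ i, u i ≠ r) = (Finset.univ.image u)ᶜ := by
      ext r; simp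
    have h3 : (Set.range u).ncard = (Finset.univ.image u).card := by
      rw [← Set.ncard_coe_finset]; simp
    rw [Finset.sum_boole, h2, h3, Finset.card_compl, Nat.cast_sub (Finset.card_le_univ _)]
    field_simp
  have h4 : ∀ r : α, ∑ u : Fin k → α, (if ∀ i, u i ≠ r then (1 : ℝ) else 0)
      = ((Fintype.card α : ℝ) - 1) ^ k := fun r ↦ by
    have h5 : (Finset.univ.filter fun u : Fin k → α ↦ ∀ i, u i ≠ r)
        = Fintype.piFinset fun _ ↦ Finset.univ.erase r := by
      ext u; simp
    rw [Finset.sum_boole, h5, Fintype.card_piFinset, Finset.prod_const,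
      Finset.card_erase_of_mem (Finset.mem_univ _)]
    simp [Nat.cast_sub (Nat.one_le_iff_ne_zero.2 (Fintype.card_ne_zero (α := α)))]
  simp_rw [h1]
  rw [← Finset.sum_div, Finset.sum_comm]
  simp_rw [h4]
  rw [Finset.sum_const, nsmul_eq_mul, Finset.card_univ, ← mul_pow, mul_sub, mul_one_div_cancel hq]
  field_simp

lemma one_sub_pow_le {x : ℝ} (hx : 0 ≤ x) (hx1 : x ≤ 1) (k : ℕ) :
    (1 - x) ^ k ≤ 1 - k * x + k ^ 2 * x ^ 2 := by
  induction k with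
  | zero => simp
  | succ k ih =>
    have h := mul_le_mul_of_nonneg_right ih (sub_nonneg.2 hx1)
    rw [pow_succ]
    refine h.trans ?_
    push_cast
    have : (0 : ℝ) ≤ k := k.cast_nonneg
    nlinarith [mul_nonneg (mul_nonneg this this) (pow_nonneg hx 3), mul_nonneg this (sq_nonneg x),
      sq_nonneg x]

/-- The normalised variable whose moments are the Euler factors. -/
noncomputable def normalizedDensity (k : ℕ) (p : Nat.Primes) (u : Fin k → ZMod (p : ℕ)) : ℝ :=
  ((1 - 1 / ((p : ℕ) : ℝ)) ^ k)⁻¹ * (1 - ((Set.range u).ncard : ℝ) / ((p : ℕ) : ℝ))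

variable (k : ℕ) (p : Nat.Primes)

lemma one_half_le_one_sub_inv : (1 / 2 : ℝ) ≤ 1 - 1 / ((p : ℕ) : ℝ) := by
  have h : (2 : ℝ) ≤ ((p : ℕ) : ℝ) := by exact_mod_cast p.2.two_le
  have : 1 / ((p : ℕ) : ℝ) ≤ 1 / 2 := by gcongr
  linarith

lemma inv_one_sub_inv_pow_le : ((1 - 1 / ((p : ℕ) : ℝ)) ^ k)⁻¹ ≤ 2 ^ k := by
  have h := one_half_le_one_sub_inv p
  rw [inv_le_comm₀ (pow_pos (by linarith) _) (by positivity), ← inv_pow]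
  gcongr
  linarith

instance : NeZero (p : ℕ) := ⟨p.2.ne_zero⟩

lemma normalizedDensity_mem (u : Fin k → ZMod (p : ℕ)) :
    0 ≤ normalizedDensity k p u ∧ normalizedDensity k p u ≤ 2 ^ k := by
  have hp : (0 : ℝ) < ((p : ℕ) : ℝ) := by exact_mod_cast p.2.pos
  have h := one_half_le_one_sub_inv p
  have ha : 0 < (1 - 1 / ((p : ℕ) : ℝ)) ^ k := pow_pos (by linarith) _
  have hy : 0 ≤ 1 - ((Set.range u).ncard : ℝ) / ((p : ℕ) : ℝ) := by
    rw [sub_nonneg, div_le_one hp]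
    have := Set.ncard_le_card (Set.range u)
    rw [Nat.card_zmod] at this
    exact_mod_cast this
  refine ⟨by unfold normalizedDensity; positivity, ?_⟩
  unfold normalizedDensity
  rw [← mul_one (2 ^ k : ℝ)]
  gcongr
  · exact inv_one_sub_inv_pow_le k p
  · have : 0 ≤ ((Set.range u).ncard : ℝ) / ((p : ℕ) : ℝ) := by positivity
    linarith

lemma integral_abs_sub_one_uniformLaw_le :
    ∫ x, |x - 1| ∂(uniformLaw (normalizedDensity k p))
      ≤ 2 ^ k * (2 * k ^ 2) * (1 / ((p : ℕ) : ℝ) ^ 2) := by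
  have hp : (0 : ℝ) < ((p : ℕ) : ℝ) := by exact_mod_cast p.2.pos
  have h := one_half_le_one_sub_inv p
  have hx : 0 ≤ 1 / ((p : ℕ) : ℝ) := by positivity
  set a := (1 - 1 / ((p : ℕ) : ℝ)) ^ k with ha_def
  set b := 1 - (k : ℝ) * (1 / ((p : ℕ) : ℝ)) with hb
  have ha : 0 < a := pow_pos (by linarith) _
  have hba : b ≤ a := by
    have := one_add_mul_le_pow (a := -(1 / ((p : ℕ) : ℝ))) (by linarith) k
    rw [← sub_eq_add_neg] at this
    linarith
  have hab : a - b ≤ k ^ 2 * (1 / ((p : ℕ) : ℝ)) ^ 2 := by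
    have := one_sub_pow_le hx (by linarith) k
    linarith
  have hu : ∀ u, |normalizedDensity k p u - 1|
      ≤ a⁻¹ * ((1 - ((Set.range u).ncard : ℝ) / ((p : ℕ) : ℝ)) + (a - 2 * b)) := fun u ↦ by
    have hby : b ≤ 1 - ((Set.range u).ncard : ℝ) / ((p : ℕ) : ℝ) := by
      have h1 : (Set.range u).ncard ≤ k := by
        have := Finite.card_range_le u
        rwa [Nat.card_fin] at this
      rw [hb, mul_one_div]
      gcongr
    have h2 : normalizedDensity k p u - 1
        = a⁻¹ * ((1 - ((Set.range u).ncard : ℝ) / ((p : ℕ) : ℝ)) - a) := by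
      rw [normalizedDensity, mul_sub _ _ a, inv_mul_cancel₀ ha.ne']
    rw [h2, abs_mul, abs_of_pos (inv_pos.2 ha)]
    gcongr
    rw [abs_le]
    constructor <;> linarith
  have hsum := sum_one_sub_ncard_range_div (α := ZMod (p : ℕ)) k
  rw [ZMod.card, ← ha_def] at hsum
  rw [integral_uniformLaw, Fintype.card_fun, Fintype.card_fin, ZMod.card]
  calc _ ≤ (((p : ℕ) ^ k : ℕ) : ℝ)⁻¹ * ∑ u : Fin k → ZMod (p : ℕ),
        a⁻¹ * ((1 - ((Set.range u).ncard : ℝ) / ((p : ℕ) : ℝ)) + (a - 2 * b)) := by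
        gcongr with u
        exact hu u
    _ = a⁻¹ * (2 * (a - b)) := by
        rw [← Finset.mul_sum, Finset.sum_add_distrib, hsum]
        simp only [Finset.sum_const, Finset.card_univ, Fintype.card_fun, Fintype.card_fin,
          ZMod.card, nsmul_eq_mul, Nat.cast_pow]
        field_simp
        ring
    _ ≤ 2 ^ k * (2 * (k ^ 2 * (1 / ((p : ℕ) : ℝ)) ^ 2)) := by
        gcongr
        · exact inv_one_sub_inv_pow_le k p
    _ = _ := by ring

lemma integral_pow_uniformLaw (m : ℕ) :
    ∫ x, x ^ m ∂(uniformLaw (normalizedDensity k p)) = muFactor k m p := by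
  rw [integral_uniformLaw, Fintype.card_fun, Fintype.card_fin, ZMod.card, muFactor, halfTerm]
  simp only [normalizedDensity, mul_pow, ← Finset.mul_sum]
  rw [zpow_neg, zpow_neg, zpow_natCast, zpow_natCast, pow_mul, inv_pow, Nat.cast_pow]
  ring

end Residues

/-- For each fixed `k ≥ 1` there is a Borel probability measure on `ℝ`, supported on
`[0, ∞)`, whose `m`-th moment is `μ_k(m)` for every integer `m ≥ 1`. -/
theorem measure_with_moments (k : ℕ) (hk : 1 ≤ k) :
    ∃ ν : Measure ℝ, IsProbabilityMeasure ν ∧ ν (Set.Iio 0) = 0 ∧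
      ∀ m : ℕ, 1 ≤ m → (∫ t, t ^ m ∂ν) = muMoment k m := by
  have hs : Summable fun p : Nat.Primes ↦ 1 / ((p : ℕ) : ℝ) ^ 2 :=
    (Real.summable_one_div_nat_pow.2 one_lt_two).comp_injective Subtype.val_injective
  have hB : ∀ p : Nat.Primes, ∀ᵐ x ∂(uniformLaw (normalizedDensity k p)), 0 ≤ x ∧ x ≤ 2 ^ k :=
    fun p ↦ ae_uniformLaw measurableSet_Icc (normalizedDensity_mem k p)
  have hs' : Summable fun p : Nat.Primes ↦ ∫ x, |x - 1| ∂(uniformLaw (normalizedDensity k p)) :=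
    .of_nonneg_of_le (fun p ↦ integral_nonneg fun x ↦ abs_nonneg _)
      (fun p ↦ integral_abs_sub_one_uniformLaw_le k p) (hs.mul_left (2 ^ k * (2 * (k : ℝ) ^ 2)))
  obtain ⟨ν, hν, h0, hm⟩ := exists_measure_moments_eq_tprod _ hB hs'
  refine ⟨ν, hν, h0, fun m hm1 ↦ ?_⟩
  rw [hm m hm1, muMoment]
  exact tprod_congr fun p ↦ integral_pow_uniformLaw k p m
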